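/- arXiv:2507.14103 — 2 statements merged into one kernel-verified Lean document; each statement's English description precedes it below -/
import Mathlib

section
/- Let r, h ∈ ℝ with h² > r² > 0 and let α: ℝ → ℝ³ be the circular helix of type III, α(s) = (h φ(s), r cosh φ(s), r sinh φ(s)) with φ(s) = s/√(h² − r²) (a unit-speed spacelike curve). Then the translation surface Ψ(s,t) = α(s) + α(t) satisfies the zero-mean-curvature equation: det(α'(s), α'(t), α''(s)) + det(α'(s), α'(t), α''(t)) = 0 for all s, t ∈ ℝ. -/
open Real

noncomputable def lprod (u v : Fin 3 → ℝ) : ℝ :=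
  u 0 * v 0 + u 1 * v 1 - u 2 * v 2

noncomputable def det3 (u v w : Fin 3 → ℝ) : ℝ :=
  u 0 * (v 1 * w 2 - v 2 * w 1) - u 1 * (v 0 * w 2 - v 2 * w 0) +
    u 2 * (v 0 * w 1 - v 1 * w 0)

theorem hasDerivAt_helix (r h k s : ℝ) :
    HasDerivAt (fun s => ![h * (s * k), r * cosh (s * k), r * sinh (s * k)])
      ![h * k, r * (sinh (s * k) * k), r * (cosh (s * k) * k)] s := by
  have hk : HasDerivAt (fun s => s * k) k s := by simpa using (hasDerivAt_id s).mul_const k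
  rw [hasDerivAt_pi]
  intro i
  fin_cases i
  · exact hk.const_mul h
  · exact hk.cosh.const_mul r
  · exact hk.sinh.const_mul r

theorem hasDerivAt_helix_velocity (r h k s : ℝ) :
    HasDerivAt (fun s => ![h * k, r * (sinh (s * k) * k), r * (cosh (s * k) * k)])
      ![0, r * (cosh (s * k) * k * k), r * (sinh (s * k) * k * k)] s := by
  have hk : HasDerivAt (fun s => s * k) k s := by simpa using (hasDerivAt_id s).mul_const k
  rw [hasDerivAt_pi]
  intro i
  fin_cases i
  · exact hasDerivAt_const s (h * k)
  · exact (hk.sinh.mul_const k).const_mul r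
  · exact (hk.cosh.mul_const k).const_mul r

/-- the translation surface `Ψ(s,t) = α(s) + α(t)` generated by a
circular helix of type III satisfies the zero-mean-curvature equation. -/
theorem stmt_12 (r h : ℝ) (h1 : r ^ 2 < h ^ 2) (h2 : 0 < r ^ 2)
    (φ : ℝ → ℝ) (hφ : ∀ s, φ s = s / Real.sqrt (h ^ 2 - r ^ 2))
    (α : ℝ → Fin 3 → ℝ)
    (hα : ∀ s, α s = ![h * φ s, r * Real.cosh (φ s), r * Real.sinh (φ s)]) :
    ∀ s t : ℝ,
      det3 (deriv α s) (deriv α t) (deriv (deriv α) s) +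
        det3 (deriv α s) (deriv α t) (deriv (deriv α) t) = 0 := by
  intro s t
  set k := (√(h ^ 2 - r ^ 2))⁻¹
  have hα' : α = fun s => ![h * (s * k), r * cosh (s * k), r * sinh (s * k)] := by
    funext s
    rw [hα, hφ, div_eq_mul_inv]
  have hd : deriv α = fun s => ![h * k, r * (sinh (s * k) * k), r * (cosh (s * k) * k)] := by
    funext s
    rw [hα', (hasDerivAt_helix r h k s).deriv]
  have hdd (s : ℝ) : deriv (deriv α) s =
      ![0, r * (cosh (s * k) * k * k), r * (sinh (s * k) * k * k)] := by
    rw [hd, (hasDerivAt_helix_velocity r h k s).deriv]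
  rw [hdd, hdd, hd]
  simp only [det3, Matrix.cons_val]
  linear_combination h * r ^ 2 * k ^ 4 * (cosh_sq_sub_sinh_sq (s * k) - cosh_sq_sub_sinh_sq (t * k))
end

section
/- Let I ⊆ ℝ be an open interval and κ: I → ℝ a smooth positive function satisfying the differential equation (κ'/κ)'(s) + κ(s)² = 0 for all s ∈ I. Then there exist c > 0 and s₀ ∈ ℝ such that κ(s) = c/cosh(c(s − s₀)) for all s ∈ I. -/
open Real

theorem IsOpen.eq_of_hasDerivAt_zero {I : Set ℝ} (hIo : IsOpen I) (hIc : Convex ℝ I)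
    {f : ℝ → ℝ} (hf : ∀ s ∈ I, HasDerivAt f 0 s) {s t : ℝ} (hs : s ∈ I) (ht : t ∈ I) :
    f s = f t :=
  hIo.is_const_of_deriv_eq_zero hIc.isPreconnected
    (fun x hx => (hf x hx).differentiableAt.differentiableWithinAt)
    (fun x hx => (hf x hx).deriv) hs ht

/-- Solutions of the first-order system `κ' = w κ`, `w' = -κ²` with `κ > 0`:
`w² + κ²` and `(c - w) / κ * exp (-c s)` are first integrals. -/
theorem exists_eq_div_cosh_of_hasDerivAt {I : Set ℝ} (hIo : IsOpen I) (hIc : Convex ℝ I)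
    {κ w : ℝ → ℝ} (hpos : ∀ s ∈ I, 0 < κ s)
    (hκ : ∀ s ∈ I, HasDerivAt κ (w s * κ s) s)
    (hw : ∀ s ∈ I, HasDerivAt w (-κ s ^ 2) s) :
    ∃ c : ℝ, 0 < c ∧ ∃ s₀ : ℝ, ∀ s ∈ I, κ s = c / Real.cosh (c * (s - s₀)) := by
  rcases I.eq_empty_or_nonempty with rfl | ⟨a, ha⟩
  · exact ⟨1, one_pos, 0, by simp⟩
  have energy : ∀ s ∈ I, w s ^ 2 + κ s ^ 2 = w a ^ 2 + κ a ^ 2 := fun s hs =>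
    hIo.eq_of_hasDerivAt_zero hIc (f := fun u => w u ^ 2 + κ u ^ 2)
      (fun u hu => (((hw u hu).pow 2).add ((hκ u hu).pow 2)).congr_deriv
        (by push_cast; ring)) hs ha
  have hκa := hpos a ha
  obtain ⟨c, hc, hc2⟩ : ∃ c : ℝ, 0 < c ∧ c ^ 2 = w a ^ 2 + κ a ^ 2 :=
    ⟨√(w a ^ 2 + κ a ^ 2), by positivity, Real.sq_sqrt (by positivity)⟩
  have energy_c : ∀ s ∈ I, (c - w s) * (c + w s) = κ s ^ 2 := fun s hs => by
    linarith [energy s hs, mul_comm (c - w s) (c + w s), sq_sub_sq c (w s)]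
  have w_lt : ∀ s ∈ I, w s < c := fun s hs =>
    lt_of_pow_lt_pow_left₀ 2 hc.le (by nlinarith [energy s hs, hpos s hs])
  have const : ∀ s ∈ I, (c - w s) / κ s * exp (-(c * s)) = (c - w a) / κ a * exp (-(c * a)) := by
    refine fun s hs => hIo.eq_of_hasDerivAt_zero hIc
      (f := fun u => (c - w u) / κ u * exp (-(c * u))) (fun u hu => ?_) hs ha
    have hne := (hpos u hu).ne'
    refine ((((hw u hu).const_sub c).div (hκ u hu) hne).mul
      (((hasDerivAt_id u).const_mul c).neg.exp)).congr_deriv ?_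
    simp only [id, mul_one, Pi.div_apply, Pi.neg_apply]
    field_simp
    linear_combination -exp (-(c * u)) * energy_c u hu
  obtain ⟨s₀, hs₀⟩ : ∃ s₀ : ℝ, exp (-(c * s₀)) = (c - w a) / κ a * exp (-(c * a)) := by
    have hA : 0 < (c - w a) / κ a * exp (-(c * a)) :=
      mul_pos (div_pos (sub_pos.2 (w_lt a ha)) hκa) (exp_pos _)
    refine ⟨-log ((c - w a) / κ a * exp (-(c * a))) / c, ?_⟩
    rw [mul_div_cancel₀ _ hc.ne', neg_neg, exp_log hA]
  refine ⟨c, hc, s₀, fun s hs => ?_⟩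
  have hκs := hpos s hs
  have hsub := sub_pos.2 (w_lt s hs)
  have hexp : exp (c * (s - s₀)) = (c - w s) / κ s := by
    rw [show c * (s - s₀) = c * s + -(c * s₀) by ring, exp_add, hs₀, ← const s hs,
      mul_left_comm, ← exp_add, add_neg_cancel, exp_zero, mul_one]
  have hexp_neg : exp (-(c * (s - s₀))) = (c + w s) / κ s := by
    rw [exp_neg, hexp, inv_div, div_eq_div_iff hsub.ne' hκs.ne']
    linear_combination -energy_c s hs
  rw [cosh_eq, hexp, hexp_neg,
    show ((c - w s) / κ s + (c + w s) / κ s) / 2 = c / κ s by ring, div_div_cancel₀ hc.ne']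

/-- the positive solutions of `(κ'/κ)' + κ² = 0` on an open interval
are `κ(s) = c / cosh(c(s − s₀))` with `c > 0`. -/
theorem stmt_14 (I : Set ℝ) (hIo : IsOpen I) (hIc : Convex ℝ I)
    (κ : ℝ → ℝ) (hκsm : ContDiffOn ℝ (⊤ : ℕ∞) κ I)
    (hκpos : ∀ s ∈ I, 0 < κ s)
    (hode : ∀ s ∈ I, deriv (fun u => deriv κ u / κ u) s + κ s ^ 2 = 0) :
    ∃ c : ℝ, 0 < c ∧ ∃ s₀ : ℝ, ∀ s ∈ I, κ s = c / Real.cosh (c * (s - s₀)) := by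
  have hd : ∀ s ∈ I, DifferentiableAt ℝ κ s := fun s hs =>
    (hκsm.differentiableOn (by simp)).differentiableAt (hIo.mem_nhds hs)
  have hd' : ∀ s ∈ I, DifferentiableAt ℝ (deriv κ) s := fun s hs =>
    ((hκsm.deriv_of_isOpen (m := 1) hIo (WithTop.coe_le_coe.2 le_top)).differentiableOn
      one_ne_zero).differentiableAt (hIo.mem_nhds hs)
  refine exists_eq_div_cosh_of_hasDerivAt hIo hIc (w := fun u => deriv κ u / κ u) hκpos
    (fun s hs => ?_) (fun s hs => ?_)
  · simpa [div_mul_cancel₀ _ (hκpos s hs).ne'] using (hd s hs).hasDerivAt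
  · rw [← eq_neg_of_add_eq_zero_left (hode s hs)]
    exact ((hd' s hs).div (hd s hs) (hκpos s hs).ne').hasDerivAt
end
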